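/- For every integer r ≥ 1 and every i ≥ 0, the polynomials c_i^{(r)}(q) of Theorem 1.1 are given by the formula c_i^{(r)}(q) = q^{(r−2)·C(i,2) − i} · ∑_{k=0}^{i} q^{r·C(k+1,2)} · P_{k,i}^{(r)}(q), where C(m,2) = m(m−1)/2 and P_{k,i}^{(r)}(q) = 0 if i > kr. -/

import Mathlib

open Polynomial LaurentPolynomial Finset

/-- The Gaussian (q-)binomial coefficient `[n choose k]_q` as a polynomial in `q`,
defined by the q-Pascal recursion; it equals `(q)_n / ((q)_k (q)_{n-k})` for `0 ≤ k ≤ n`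
and vanishes for `k > n`. -/
noncomputable def qbinom : ℕ → ℕ → Polynomial ℤ
  | _, 0 => 1
  | 0, _ + 1 => 0
  | n + 1, k + 1 => qbinom n k + Polynomial.X ^ (k + 1) * qbinom n (k + 1)

/-- `[n choose k]_q` viewed as a Laurent polynomial. -/
noncomputable def qb (n k : ℕ) : LaurentPolynomial ℤ := (qbinom n k).toLaurent

theorem qbinom_eval_one (n k : ℕ) : (qbinom n k).eval 1 = n.choose k := by
  induction n generalizing k with
  | zero => cases k <;> simp [qbinom]
  | succ n ih =>
    cases k with
    | zero => simp [qbinom]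
    | succ k => simp [qbinom, ih, Nat.choose_succ_succ]

theorem qb_ne_zero {n k : ℕ} (h : k ≤ n) : qb n k ≠ 0 := by
  intro h0
  have h1 : qbinom n k = 0 := Polynomial.toLaurent_injective (by simpa [qb] using h0)
  have h2 := qbinom_eval_one n k
  rw [h1, Polynomial.eval_zero] at h2
  exact (Nat.choose_pos h).ne (by exact_mod_cast h2)

theorem choose_two_sub_cast {n k : ℕ} (h : k ≤ n) :
    ((n - k).choose 2 : ℤ) = n.choose 2 - n * k + (k + 1).choose 2 := by
  have two_mul_choose (m : ℕ) : (2 : ℤ) * m.choose 2 = m * (m - 1) := by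
    induction m with
    | zero => simp
    | succ m ih =>
      rw [Nat.choose_succ_succ' m 1, Nat.choose_one_right]
      push_cast
      linarith
  have h1 := two_mul_choose (n - k)
  have h2 := two_mul_choose n
  have h3 := two_mul_choose (k + 1)
  push_cast [Nat.cast_sub h] at h1 h3
  linarith

/-- Sequences agree when all their sums against a lower triangular kernel with nonzero diagonal
agree. -/
theorem eq_of_sum_range_succ_mul_eq {R : Type*} [CommRing R] [IsDomain R] {a : ℕ → ℕ → R}
    (ha : ∀ n, a n n ≠ 0) {f g : ℕ → R}
    (h : ∀ n, ∑ i ∈ range (n + 1), a n i * f i = ∑ i ∈ range (n + 1), a n i * g i) (n : ℕ) :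
    f n = g n := by
  induction n using Nat.strong_induction_on with
  | _ n ih =>
    have hn := h n
    rw [sum_range_succ, sum_range_succ,
      sum_congr rfl fun i hi => by rw [ih i (mem_range.mp hi)]] at hn
    exact mul_left_cancel₀ (ha n) (add_left_cancel hn)

/-- Formula (3.1) for the polynomials of Theorem 1.1:
`c_i^{(r)}(q) = q^{(r-2)C(i,2) - i} ∑_{k=0}^i q^{r C(k+1,2)} P_{k,i}^{(r)}(q)`,
where `P r k i` denotes the Laurent polynomial `P_{k,i}^{(r)}(q)` of Lemma 1.2
(vanishing when `i > kr`) and `c` is the sequence of polynomials of Theorem 1.1,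
both characterized by the hypotheses. -/
theorem qSchmidt_c_formula
    (r : ℕ) (hr : 1 ≤ r)
    (P : ℕ → ℕ → ℕ → LaurentPolynomial ℤ)
    (hPsupp : ∀ r k i : ℕ, i < k ∨ r * k < i → P r k i = 0)
    (hPnonneg : ∀ r k i : ℕ, ∀ m : ℤ, 0 ≤ (P r k i).coeff m)
    (hPid : ∀ r : ℕ, 1 ≤ r → ∀ k n : ℕ, k ≤ n →
      qb n k ^ r * qb (n + k) k ^ r
        = ∑ i ∈ Icc k (min n (r * k)),
            T (((r : ℤ) * k - i) * n) * qb n i * qb (n + i) i * P r k i)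
    (c : ℕ → Polynomial ℤ)
    (hcnonneg : ∀ i : ℕ, ∀ m : ℕ, 0 ≤ (c i).coeff m)
    (hcid : ∀ n : ℕ,
      ∑ k ∈ range (n + 1),
        T ((r : ℤ) * ((n - k).choose 2) + (1 - (r : ℤ)) * (n.choose 2)) *
          qb n k ^ r * qb (n + k) k ^ r
      = ∑ i ∈ range (n + 1),
        T (((n - i).choose 2 : ℤ) + (1 - (r : ℤ)) * (i.choose 2)) *
          qb n i * qb (n + i) i * (c i).toLaurent) :
    ∀ i : ℕ, (c i).toLaurent
      = T (((r : ℤ) - 2) * (i.choose 2) - i) *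
          ∑ k ∈ range (i + 1), T ((r : ℤ) * ((k + 1).choose 2)) * P r k i := by
  refine eq_of_sum_range_succ_mul_eq
    (a := fun n i => T (((n - i).choose 2 : ℤ) + (1 - (r : ℤ)) * (i.choose 2)) *
          qb n i * qb (n + i) i) (fun n => ?_) (fun n => ?_)
  · exact mul_ne_zero (mul_ne_zero (isUnit_T _).ne_zero (qb_ne_zero le_rfl))
      (qb_ne_zero (Nat.le_add_left n n))
  · rw [← hcid n]
    have expand : ∀ k ∈ range (n + 1),
        T ((r : ℤ) * ((n - k).choose 2) + (1 - (r : ℤ)) * (n.choose 2)) *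
          qb n k ^ r * qb (n + k) k ^ r
        = ∑ i ∈ range (n + 1), T ((n.choose 2 : ℤ) - n * i) * qb n i * qb (n + i) i *
            (T ((r : ℤ) * ((k + 1).choose 2)) * P r k i) := by
      intro k hk
      have hkn : k ≤ n := Nat.lt_succ_iff.mp (mem_range.mp hk)
      have hsub : Icc k (min n (r * k)) ⊆ range (n + 1) := fun i hi => by
        simp only [mem_Icc, le_min_iff, mem_range] at hi ⊢
        lia
      rw [mul_assoc, hPid r hr k n hkn, mul_sum, ← sum_subset hsub]
      · refine sum_congr rfl fun i _ => ?_
        have hT : (T ((r : ℤ) * ((n - k).choose 2) + (1 - (r : ℤ)) * (n.choose 2)) :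
              LaurentPolynomial ℤ) * T (((r : ℤ) * k - i) * n)
            = T ((n.choose 2 : ℤ) - n * i) * T ((r : ℤ) * ((k + 1).choose 2)) := by
          rw [← T_add, ← T_add, choose_two_sub_cast hkn]
          congr 1
          ring
        linear_combination qb n i * qb (n + i) i * P r k i * hT
      · intro i hi hi'
        rw [hPsupp r k i, mul_zero, mul_zero]
        simp only [mem_Icc, le_min_iff, mem_range] at hi hi'
        lia
    rw [sum_congr rfl expand, sum_comm]
    refine sum_congr rfl fun i hi => ?_
    have hin : i ≤ n := Nat.lt_succ_iff.mp (mem_range.mp hi)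
    have hT : (T (((n - i).choose 2 : ℤ) + (1 - (r : ℤ)) * (i.choose 2)) :
          LaurentPolynomial ℤ) * T (((r : ℤ) - 2) * (i.choose 2) - i)
        = T ((n.choose 2 : ℤ) - n * i) := by
      rw [← T_add, choose_two_sub_cast hin, Nat.choose_succ_succ' i 1, Nat.choose_one_right]
      congr 1
      push_cast
      ring
    have htrunc : ∑ k ∈ range (i + 1), T ((r : ℤ) * ((k + 1).choose 2)) * P r k i
        = ∑ k ∈ range (n + 1), T ((r : ℤ) * ((k + 1).choose 2)) * P r k i := by
      refine sum_subset (range_mono (by lia)) fun k _ hk => ?_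
      rw [hPsupp r k i (Or.inl (by simpa using hk)), mul_zero]
    rw [← mul_sum, htrunc, ← hT]
    ring
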